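/- Let u be a map continuously differentiable on a neighborhood of the closure of Ω with values in ℝ^n, and let a ∈ ℝ^n be such that a ∉ u(∂Ω) and det∇u(x) ≠ 0 for every x ∈ Ω with u(x) = a. Then the set {x ∈ Ω : u(x) = a} is finite, j u^a ∈ L^1(Ω;ℝ^n), and for every ψ ∈ C^1_c(Ω), −∫_Ω j u^a(x)·∇ψ(x) dx = ω_n · Σ_{x ∈ Ω, u(x)=a} sgn(det∇u(x)) ψ(x); that is, Ju^a = ω_n Σ_{x ∈ u^{−1}(a)} sgn(det∇u(x)) δ_x as distributions on Ω. -/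

import Mathlib

open MeasureTheory Metric Filter Topology

noncomputable section

abbrev Euc (n : ℕ) := EuclideanSpace ℝ (Fin n)

/-- The Jacobian matrix `∇u(x)` of a map `u : ℝⁿ → ℝⁿ`, with entries `∂_j u_i (x)`. -/
def jacMat (n : ℕ) (u : Euc n → Euc n) (x : Euc n) : Matrix (Fin n) (Fin n) ℝ :=
  Matrix.of fun i j => fderiv ℝ u x (EuclideanSpace.single j 1) i

/-- The vector field `j u := (1/n) (cof ∇u)ᵀ u` (componentwise); note that
`(cof A)ᵀ = adjugate A`. -/
def jvec (n : ℕ) (u : Euc n → Euc n) (x : Euc n) : Fin n → ℝ :=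
  fun i => (n : ℝ)⁻¹ * Matrix.mulVec (Matrix.adjugate (jacMat n u x)) (fun j => u x j) i

/-- The pointwise pairing `j u (x) · ∇ψ(x)`. -/
def jPair (n : ℕ) (u : Euc n → Euc n) (ψ : Euc n → ℝ) (x : Euc n) : ℝ :=
  ∑ i, jvec n u x i * fderiv ℝ ψ x (EuclideanSpace.single i 1)

/-- `ψ ∈ C¹_c(Ω)`. -/
def Cc1 (n : ℕ) (Ω : Set (Euc n)) (ψ : Euc n → ℝ) : Prop :=
  ContDiff ℝ 1 ψ ∧ HasCompactSupport ψ ∧ tsupport ψ ⊆ Ω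

/-- The fractional Sobolev seminorm `[u]_{W^{s,p}(Ω)}`. -/
def sobSemi (n : ℕ) (s p : ℝ) (Ω : Set (Euc n)) {F : Type*} [NormedAddCommGroup F]
    (u : Euc n → F) : ℝ :=
  (∫ x in Ω, ∫ y in Ω, ‖u x - u y‖ ^ p / dist x y ^ ((n : ℝ) + s * p)) ^ (1 / p)

/-- The fractional Sobolev norm `‖u‖_{W^{s,p}(Ω)} = ‖u‖_{L^p(Ω)} + [u]_{W^{s,p}(Ω)}`. -/
def sobNorm (n : ℕ) (s p : ℝ) (Ω : Set (Euc n)) {F : Type*} [NormedAddCommGroup F]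
    (u : Euc n → F) : ℝ :=
  (∫ x in Ω, ‖u x‖ ^ p) ^ (1 / p) + sobSemi n s p Ω u

/-- Membership `u ∈ W^{s,p}(Ω; F)`: `u ∈ L^p(Ω)` and the double integral defining
`[u]_{W^{s,p}(Ω)}^p` is finite. -/
def MemWsp (n : ℕ) (s p : ℝ) (Ω : Set (Euc n)) {F : Type*} [NormedAddCommGroup F]
    (u : Euc n → F) : Prop :=
  AEStronglyMeasurable u (volume.restrict Ω) ∧
  Integrable (fun x => ‖u x‖ ^ p) (volume.restrict Ω) ∧
  Integrable (fun q : Euc n × Euc n => ‖u q.1 - u q.2‖ ^ p / dist q.1 q.2 ^ ((n : ℝ) + s * p))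
    ((volume.restrict Ω).prod (volume.restrict Ω))

/-- `Ω` has smooth boundary: it is a sublevel set of a smooth function whose
differential does not vanish on the boundary. -/
def SmoothBoundary (n : ℕ) (Ω : Set (Euc n)) : Prop :=
  ∃ f : Euc n → ℝ, ContDiff ℝ (⊤ : ℕ∞) f ∧ Ω = f ⁻¹' Set.Iio 0 ∧
    ∀ x ∈ frontier Ω, fderiv ℝ f x ≠ 0

/-- `u^a(x) = (u(x) - a)/|u(x) - a|`. -/
def proj (n : ℕ) (u : Euc n → Euc n) (a : Euc n) : Euc n → Euc n :=
  fun x => ‖u x - a‖⁻¹ • (u x - a)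

/-- The set of Hölder quotients of `u` on `Ω`. -/
def holderSet (n : ℕ) (α : ℝ) (Ω : Set (Euc n)) {F : Type*} [NormedAddCommGroup F]
    (u : Euc n → F) : Set ℝ :=
  {r | ∃ x ∈ Ω, ∃ y ∈ Ω, x ≠ y ∧ r = ‖u x - u y‖ / dist x y ^ α}

/-- The Hölder seminorm `[u]_{C^{0,α}(Ω)}`. -/
def holderSemi (n : ℕ) (α : ℝ) (Ω : Set (Euc n)) {F : Type*} [NormedAddCommGroup F]
    (u : Euc n → F) : ℝ :=
  sSup (holderSet n α Ω u)

/-- The Hölder norm `‖u‖_{C^{0,α}(Ω)} = sup_Ω ‖u‖ + [u]_{C^{0,α}(Ω)}`. -/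
def holderNorm (n : ℕ) (α : ℝ) (Ω : Set (Euc n)) {F : Type*} [NormedAddCommGroup F]
    (u : Euc n → F) : ℝ :=
  sSup {r | ∃ x ∈ Ω, r = ‖u x‖} + holderSemi n α Ω u

/-- the volume `ω_n` of the unit ball of `ℝⁿ`. -/
def ballVol (n : ℕ) : ℝ := (volume (ball (0 : Euc n) 1)).toReal

/-- `⟨Jv, ψ⟩ = J` for `v ∈ W^{(n-1)/n, n}(Ω; ℝⁿ)`: approximating sequences of maps which are
`C¹` up to the boundary exist, and for every such sequence the Jacobian integrals converge
to `J`. -/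
def JPairing (n : ℕ) (Ω : Set (Euc n)) (v : Euc n → Euc n) (ψ : Euc n → ℝ) (J : ℝ) : Prop :=
  (∃ vk : ℕ → Euc n → Euc n, (∀ k, ContDiffOn ℝ 1 (vk k) (closure Ω)) ∧
      Tendsto (fun k => sobNorm n (((n : ℝ) - 1) / n) n Ω (vk k - v)) atTop (𝓝 0) ∧
      Tendsto (fun k => ∫ x in Ω, (jacMat n (vk k) x).det * ψ x) atTop (𝓝 J)) ∧
  (∀ vk : ℕ → Euc n → Euc n, (∀ k, ContDiffOn ℝ 1 (vk k) (closure Ω)) →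
      Tendsto (fun k => sobNorm n (((n : ℝ) - 1) / n) n Ω (vk k - v)) atTop (𝓝 0) →
      Tendsto (fun k => ∫ x in Ω, (jacMat n (vk k) x).det * ψ x) atTop (𝓝 J))

/-- The set of values `⟨Jv, ψ⟩` over test functions `ψ ∈ C¹_c(Ω)` with `|ψ| ≤ 1`;
its supremum is the total variation `|Jv|_{TV}`. -/
def TVset (n : ℕ) (Ω : Set (Euc n)) (v : Euc n → Euc n) : Set ℝ :=
  {r | ∃ ψ : Euc n → ℝ, Cc1 n Ω ψ ∧ (∀ x, |ψ x| ≤ 1) ∧ JPairing n Ω v ψ r}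

/-- `⟨Jv, ψ⟩ = -∫_Ω j v · ∇ψ` for (pointwise defined) `v`. -/
def jpairOn (n : ℕ) (Ω : Set (Euc n)) (v : Euc n → Euc n) (ψ : Euc n → ℝ) : ℝ :=
  -∫ x in Ω, jPair n v ψ x

/-- The `W^{-1,1}(Ω)` distance between two functionals on test functions:
`sup { S ψ - T ψ : ψ ∈ C¹_c(Ω), Lip ψ ≤ 1 }`. -/
def Wm11dist (n : ℕ) (Ω : Set (Euc n)) (S T : (Euc n → ℝ) → ℝ) : ℝ :=
  sSup {r | ∃ ψ : Euc n → ℝ, Cc1 n Ω ψ ∧ LipschitzWith 1 ψ ∧ r = S ψ - T ψ}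


/-! ### Matrices of continuous linear maps -/

/-- The matrix of a continuous linear endomorphism in the standard basis. -/
def toMat (n : ℕ) (L : Euc n →L[ℝ] Euc n) : Matrix (Fin n) (Fin n) ℝ :=
  Matrix.of fun i j => L (EuclideanSpace.single j 1) i

lemma toMat_eq (n : ℕ) (L : Euc n →L[ℝ] Euc n) :
    toMat n L = LinearMap.toMatrix (EuclideanSpace.basisFun (Fin n) ℝ).toBasis
      (EuclideanSpace.basisFun (Fin n) ℝ).toBasis (L : Euc n →ₗ[ℝ] Euc n) := by
  ext i j
  simp [toMat, LinearMap.toMatrix_apply]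

lemma jacMat_eq (n : ℕ) (u : Euc n → Euc n) (x : Euc n) :
    jacMat n u x = toMat n (fderiv ℝ u x) := rfl

lemma toMat_comp (n : ℕ) (L M : Euc n →L[ℝ] Euc n) :
    toMat n (L ∘L M) = toMat n L * toMat n M := by
  rw [toMat_eq, toMat_eq, toMat_eq, ← LinearMap.toMatrix_comp]
  rfl

lemma toMat_id (n : ℕ) : toMat n (ContinuousLinearMap.id ℝ (Euc n)) = 1 := by
  rw [toMat_eq]
  exact LinearMap.toMatrix_id _

lemma toMat_add (n : ℕ) (L M : Euc n →L[ℝ] Euc n) :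
    toMat n (L + M) = toMat n L + toMat n M := by
  ext i j; simp [toMat]

lemma toMat_smul (n : ℕ) (c : ℝ) (L : Euc n →L[ℝ] Euc n) :
    toMat n (c • L) = c • toMat n L := by
  ext i j; simp [toMat]

lemma toMat_zero (n : ℕ) : toMat n 0 = 0 := by
  ext i j; simp [toMat]

lemma toMat_det (n : ℕ) (L : Euc n →L[ℝ] Euc n) : (toMat n L).det = L.det := by
  rw [toMat_eq, LinearMap.det_toMatrix]

lemma toMat_mulVec (n : ℕ) (L : Euc n →L[ℝ] Euc n) (v : Euc n) (i : Fin n) :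
    Matrix.mulVec (toMat n L) (fun j => v j) i = L v i := by
  have h := LinearMap.toMatrix_mulVec_repr (EuclideanSpace.basisFun (Fin n) ℝ).toBasis
    (EuclideanSpace.basisFun (Fin n) ℝ).toBasis (L : Euc n →ₗ[ℝ] Euc n) v
  rw [← toMat_eq] at h
  have h2 := congrFun h i
  have h3 : ⇑((EuclideanSpace.basisFun (Fin n) ℝ).toBasis.repr v) = fun j => v j := by
    ext j; simp
  rw [h3] at h2
  simpa using h2

lemma continuous_toMat (n : ℕ) : Continuous (toMat n) := by
  refine continuous_matrix fun i j => ?_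
  have h1 : Continuous fun L : Euc n →L[ℝ] Euc n => L (EuclideanSpace.single j 1) := by fun_prop
  exact (EuclideanSpace.proj (𝕜 := ℝ) i).continuous.comp h1

/-! ### Expansion of the determinant and extraction of coefficients -/

lemma poly_extract {ι : Type*} (s : Finset ι) (d : ι → ℕ) (c : ι → ℝ) (ε : ℝ) (hε : 0 < ε)
    (h : ∀ t ∈ Set.Ioo 0 ε, ∑ i ∈ s, t ^ d i * c i = 0) (k : ℕ) :
    ∑ i ∈ s with d i = k, c i = 0 := by
  set p : Polynomial ℝ := ∑ i ∈ s, Polynomial.C (c i) * Polynomial.X ^ d i with hp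
  have hp0 : p = 0 := by
    apply Polynomial.eq_zero_of_infinite_isRoot
    refine (Set.Ioo_infinite hε).mono fun t ht => ?_
    simp only [Set.mem_ofPred_eq, Polynomial.IsRoot, hp, Polynomial.eval_finsetSum]
    refine (Finset.sum_congr rfl fun i _ => ?_).trans (h t ht)
    rw [Polynomial.eval_mul, Polynomial.eval_C, Polynomial.eval_pow, Polynomial.eval_X, mul_comm]
  have h2 : p.coeff k = 0 := by rw [hp0]; simp
  rw [hp, Polynomial.finsetSum_coeff] at h2
  rw [Finset.sum_filter]
  refine (Finset.sum_congr rfl fun i _ => ?_).trans h2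
  rw [Polynomial.coeff_C_mul, Polynomial.coeff_X_pow]
  by_cases hk : d i = k
  · simp [hk]
  · simp [hk, Ne.symm hk]

/-- Determinant with rows in `S` from `A`, others from `B`. -/
def dS (n : ℕ) (A B : Matrix (Fin n) (Fin n) ℝ) (S : Finset (Fin n)) : ℝ :=
  Matrix.det (Matrix.of fun i j => if i ∈ S then A i j else B i j)

lemma det_expand_aux (n : ℕ) (A B : Fin n → Fin n → ℝ) (t : ℝ) :
    Matrix.det (Matrix.of (t • A + B)) = ∑ S : Finset (Fin n), t ^ S.card *
      Matrix.det (Matrix.of fun i j => if i ∈ S then A i j else B i j) := by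
  have h := (Matrix.detRowAlternating (n := Fin n) (R := ℝ)).toMultilinearMap.map_add_univ
    (t • A) B
  refine h.trans (Finset.sum_congr rfl fun S _ => ?_)
  have h2 := (Matrix.detRowAlternating (n := Fin n) (R := ℝ)).toMultilinearMap.map_piecewise_smul
    (fun _ => t) (S.piecewise A B) S
  have e2 : S.piecewise (t • A) B
      = S.piecewise (fun i => t • (S.piecewise A B) i) (S.piecewise A B) := by
    ext i j
    by_cases hi : i ∈ S <;> simp [hi]
  have e3 : S.piecewise A B = fun i j => if i ∈ S then A i j else B i j := by
    ext i j
    by_cases hi : i ∈ S <;> simp [hi]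
  rw [e2]
  refine h2.trans ?_
  rw [Finset.prod_const, smul_eq_mul, e3]
  rfl

lemma det_expand (n : ℕ) (A B : Matrix (Fin n) (Fin n) ℝ) (t : ℝ) :
    (B + t • A).det = ∑ S : Finset (Fin n), t ^ S.card * dS n A B S := by
  rw [add_comm]
  exact det_expand_aux n A B t

lemma dS_empty (n : ℕ) (A B : Matrix (Fin n) (Fin n) ℝ) : dS n A B ∅ = B.det := by
  simp [dS]
  rfl

lemma dS_univ (n : ℕ) (A B : Matrix (Fin n) (Fin n) ℝ) : dS n A B Finset.univ = A.det := by
  simp [dS]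
  rfl

lemma dS_singleton (n : ℕ) (A B : Matrix (Fin n) (Fin n) ℝ) (i : Fin n) :
    dS n A B {i} = (A * B.adjugate) i i := by
  have : dS n A B {i} = (B.updateRow i (A i)).det := by
    unfold dS
    congr 1
    ext k j
    by_cases hk : k = i
    · subst hk; simp
    · simp [hk]
  rw [this, ← Matrix.cramer_transpose_apply, Matrix.cramer_eq_adjugate_mulVec,
    ← Matrix.adjugate_transpose, Matrix.mul_apply, Matrix.mulVec, dotProduct]
  exact Finset.sum_congr rfl fun j _ => by rw [Matrix.transpose_apply, mul_comm]

lemma sum_dS_one (n : ℕ) (A B : Matrix (Fin n) (Fin n) ℝ) :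
    ∑ S : Finset (Fin n) with S.card = 1, dS n A B S = (A * B.adjugate).trace := by
  have : (Finset.univ.filter fun S : Finset (Fin n) => S.card = 1)
      = Finset.univ.map ⟨fun i : Fin n => ({i} : Finset (Fin n)), Finset.singleton_injective⟩ := by
    ext S
    simp [Finset.card_eq_one, eq_comm]
  rw [this, Finset.sum_map, Matrix.trace]
  exact Finset.sum_congr rfl fun i _ => dS_singleton n A B i

lemma continuous_dS {X : Type*} [TopologicalSpace X] (n : ℕ)
    {A B : X → Matrix (Fin n) (Fin n) ℝ} (hA : Continuous A) (hB : Continuous B)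
    (S : Finset (Fin n)) : Continuous fun x => dS n (A x) (B x) S := by
  unfold dS
  refine Continuous.matrix_det (continuous_matrix fun i j => ?_)
  by_cases hi : i ∈ S
  · simpa [hi] using hA.matrix_elem i j
  · simpa [hi] using hB.matrix_elem i j


/-! ### The integral of a null Lagrangian -/

lemma perturb_id_bij (n : ℕ) (hn : 1 ≤ n) (θ : Euc n → Euc n) (C : NNReal)
    (hθ : LipschitzWith C θ) (s : ℝ) (hs : 0 ≤ s) (hsC : s * C ≤ 1 / 2) :
    Function.Bijective fun x => x + s • θ x := by
  have : Nonempty (Fin n) := ⟨⟨0, hn⟩⟩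
  have h : ApproximatesLinearOn (fun x => x + s • θ x)
      ((ContinuousLinearEquiv.refl ℝ (Euc n) : Euc n ≃L[ℝ] Euc n) : Euc n →L[ℝ] Euc n)
      Set.univ (1 / 2 : NNReal) := by
    intro x _ y _
    have e : (x + s • θ x) - (y + s • θ y) - (x - y) = s • (θ x - θ y) := by
      rw [smul_sub]; abel
    have h1 := hθ.norm_sub_le x y
    calc ‖(x + s • θ x) - (y + s • θ y) - (x - y)‖ = s * ‖θ x - θ y‖ := by
          rw [e, norm_smul, Real.norm_of_nonneg hs]
      _ ≤ s * (C * ‖x - y‖) := by gcongr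
      _ = (s * C) * ‖x - y‖ := by ring
      _ ≤ (1 / 2) * ‖x - y‖ := by gcongr
      _ = _ := by norm_num
  have hc : (1 / 2 : NNReal) < ‖(((ContinuousLinearEquiv.refl ℝ (Euc n)).symm : Euc n ≃L[ℝ] Euc n) :
      Euc n →L[ℝ] Euc n)‖₊⁻¹ := by
    have : ‖(((ContinuousLinearEquiv.refl ℝ (Euc n)).symm : Euc n ≃L[ℝ] Euc n) :
      Euc n →L[ℝ] Euc n)‖₊ = 1 := by
      ext
      exact ContinuousLinearMap.norm_id
    rw [this, inv_one]
    exact NNReal.half_lt_self one_ne_zero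
  refine ⟨?_, h.surjective (Or.inr hc)⟩
  exact Set.injOn_univ.1 (h.injOn (Or.inr hc))

lemma det_pos_small (n : ℕ) : ∃ δ > 0, ∀ L : Euc n →L[ℝ] Euc n, ‖L‖ < δ →
    0 < (ContinuousLinearMap.id ℝ (Euc n) + L).det := by
  have hc : Continuous fun L : Euc n →L[ℝ] Euc n =>
      (toMat n (ContinuousLinearMap.id ℝ (Euc n) + L)).det :=
    ((continuous_toMat n).comp (continuous_const.add continuous_id)).matrix_det
  have h0 : 0 < (toMat n (ContinuousLinearMap.id ℝ (Euc n) + 0)).det := by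
    rw [add_zero, toMat_id, Matrix.det_one]; exact one_pos
  have := (hc.continuousAt (x := 0)).eventually (lt_mem_nhds h0)
  obtain ⟨δ, hδ, h⟩ := Metric.eventually_nhds_iff.1 this
  refine ⟨δ, hδ, fun L hL => ?_⟩
  rw [← toMat_det]
  exact h (by simpa using hL)

lemma setIntegral_det_perturb (n : ℕ) (hn : 1 ≤ n) (θ : Euc n → Euc n) (hθ : ContDiff ℝ 1 θ)
    (hc : HasCompactSupport θ) (B : Set (Euc n)) (hB : IsCompact B) (hB' : tsupport θ ⊆ B) :
    ∃ ε > 0, ∀ s ∈ Set.Ioo (0 : ℝ) ε,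
      ∫ x in B, (1 + s • toMat n (fderiv ℝ θ x)).det = ∫ x in B, (1 : ℝ) := by
  obtain ⟨C, hC⟩ := hθ.lipschitzWith_of_hasCompactSupport hc one_ne_zero
  obtain ⟨δ, hδ, hdet⟩ := det_pos_small n
  have hC1 : (0 : ℝ) < C + 1 := by positivity
  refine ⟨min (1 / 2 / (C + 1)) (δ / (C + 1)), by positivity, fun s hs => ?_⟩
  have hs0 : 0 < s := hs.1
  have h1 : s * (C + 1) < 1 / 2 := (lt_div_iff₀ hC1).1 (hs.2.trans_le (min_le_left _ _))
  have h2 : s * (C + 1) < δ := (lt_div_iff₀ hC1).1 (hs.2.trans_le (min_le_right _ _))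
  have bij := perturb_id_bij n hn θ C hC s hs0.le (by nlinarith)
  set T : Euc n → Euc n := fun x => x + s • θ x with hT
  have hTB : T '' B = B := by
    have hout : ∀ x, x ∉ B → T x = x := by
      intro x hx
      have : θ x = 0 := image_eq_zero_of_notMem_tsupport fun h => hx (hB' h)
      simp [hT, this]
    apply Set.Subset.antisymm
    · rintro _ ⟨x, hx, rfl⟩
      by_contra h
      have := bij.1 (hout _ h)
      rw [this] at h
      exact h hx
    · intro y hy
      obtain ⟨x, rfl⟩ := bij.2 y
      by_cases hx : x ∈ B
      · exact ⟨x, hx, rfl⟩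
      · rw [hout x hx] at hy; exact absurd hy hx
  have hder : ∀ x, HasFDerivAt T (ContinuousLinearMap.id ℝ (Euc n) + s • fderiv ℝ θ x) x :=
    fun x => (hasFDerivAt_id x).add
      ((hθ.differentiable one_ne_zero x).hasFDerivAt.const_smul s)
  have key := integral_image_eq_integral_abs_det_fderiv_smul volume hB.measurableSet
    (fun x _ => (hder x).hasFDerivWithinAt) bij.1.injOn (fun _ => (1 : ℝ))
  rw [hTB] at key
  rw [key]
  congr 1
  ext x
  have hL : ‖s • fderiv ℝ θ x‖ < δ := by
    rw [norm_smul, Real.norm_of_nonneg hs0.le]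
    have := norm_fderiv_le_of_lipschitz ℝ hC (x₀ := x)
    nlinarith
  rw [abs_of_pos (hdet _ hL), smul_eq_mul, mul_one, ← toMat_det, toMat_add, toMat_id, toMat_smul]

lemma continuous_jac (n : ℕ) (θ : Euc n → Euc n) (hθ : ContDiff ℝ 1 θ) :
    Continuous fun x => toMat n (fderiv ℝ θ x) :=
  (continuous_toMat n).comp (hθ.continuous_fderiv one_ne_zero)

lemma setIntegral_det_expand (n : ℕ) (M N : Euc n → Matrix (Fin n) (Fin n) ℝ) (hM : Continuous M)
    (hN : Continuous N) (B : Set (Euc n)) (hB : IsCompact B) (t : ℝ) :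
    ∫ x in B, (N x + t • M x).det
      = ∑ S : Finset (Fin n), t ^ S.card * ∫ x in B, dS n (M x) (N x) S := by
  simp_rw [det_expand]
  rw [integral_finsetSum]
  · exact Finset.sum_congr rfl fun S _ => integral_const_mul _ _
  · intro S _
    exact ((continuous_dS n hM hN S).continuousOn.integrableOn_compact hB).const_mul _

lemma setIntegral_det_zero (n : ℕ) (hn : 1 ≤ n) (θ : Euc n → Euc n) (hθ : ContDiff ℝ 1 θ)
    (hc : HasCompactSupport θ) (B : Set (Euc n)) (hB : IsCompact B) (hB' : tsupport θ ⊆ B) :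
    ∫ x in B, (toMat n (fderiv ℝ θ x)).det = 0 := by
  obtain ⟨ε, hε, h⟩ := setIntegral_det_perturb n hn θ hθ hc B hB hB'
  have hM := continuous_jac n θ hθ
  have h2 := poly_extract (Finset.univ : Finset (Finset (Fin n))) Finset.card
    (fun S => (∫ x in B, dS n (toMat n (fderiv ℝ θ x)) 1 S)
      - if S = ∅ then ∫ x in B, (1 : ℝ) else 0) ε hε (fun t ht => by
        have h3 := h t ht
        rw [setIntegral_det_expand n _ (fun _ => 1) hM continuous_const B hB t] at h3
        simp only [mul_sub, Finset.sum_sub_distrib, h3]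
        simp) n
  have e : (Finset.univ.filter fun S : Finset (Fin n) => S.card = n) = {Finset.univ} := by
    ext S
    simp only [Finset.mem_filter, Finset.mem_univ, true_and, Finset.mem_singleton]
    rw [← Finset.card_eq_iff_eq_univ, Fintype.card_fin]
  have hne : (Finset.univ : Finset (Fin n)) ≠ ∅ := by
    have : Nonempty (Fin n) := ⟨⟨0, hn⟩⟩
    exact Finset.univ_nonempty.ne_empty
  rw [e, Finset.sum_singleton, if_neg hne, sub_zero] at h2
  simpa only [dS_univ] using h2

/-- The weak Piola identity. -/
lemma weak_piola (n : ℕ) (hn : 1 ≤ n) (θ φ : Euc n → Euc n) (hθ : ContDiff ℝ 1 θ)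
    (hθc : HasCompactSupport θ) (hφ : ContDiff ℝ 1 φ) (hφc : HasCompactSupport φ)
    (B : Set (Euc n)) (hB : IsCompact B) (hθB : tsupport θ ⊆ B) (hφB : tsupport φ ⊆ B) :
    ∫ x in B, (toMat n (fderiv ℝ φ x) * (toMat n (fderiv ℝ θ x)).adjugate).trace = 0 := by
  have hM := continuous_jac n θ hθ
  have hN := continuous_jac n φ hφ
  have h2 := poly_extract (Finset.univ : Finset (Finset (Fin n))) Finset.card
    (fun S => ∫ x in B, dS n (toMat n (fderiv ℝ φ x)) (toMat n (fderiv ℝ θ x)) S) 1 one_pos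
      (fun t ht => by
        rw [← setIntegral_det_expand n _ _ hN hM B hB t]
        have hs : HasCompactSupport (θ + t • φ) := hθc.add (hφc.smul_left (f := fun _ => t))
        have h3 := setIntegral_det_zero n hn (θ + t • φ) (hθ.add (hφ.const_smul t)) hs B hB
          (by
            refine (tsupport_add _ _).trans (Set.union_subset hθB ?_)
            exact (tsupport_smul_subset_right (fun _ => t) φ).trans hφB)
        rw [← h3]
        congr 1
        ext x
        have hd : fderiv ℝ (θ + t • φ) x = fderiv ℝ θ x + t • fderiv ℝ φ x :=
          ((hθ.differentiable one_ne_zero x).hasFDerivAt.add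
            ((hφ.differentiable one_ne_zero x).hasFDerivAt.const_smul t)).fderiv
        rw [hd, toMat_add, toMat_smul]) 1
  rw [← integral_finsetSum] at h2
  · simpa only [sum_dS_one] using h2
  · intro S _
    exact (continuous_dS n hN hM S).continuousOn.integrableOn_compact hB


/-! ### The regularised radial field -/

/-- Regularised profile. -/
def gprof (n : ℕ) (ε s : ℝ) : ℝ := (n : ℝ)⁻¹ * (Real.sqrt (ε ^ 2 + s) ^ n)⁻¹

/-- Regularised radial field. -/
def Fe (n : ℕ) (ε : ℝ) (y : Euc n) : Euc n := gprof n ε (‖y‖ ^ 2) • y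

/-- Divergence of the regularised radial field. -/
def fe (n : ℕ) (ε : ℝ) (y : Euc n) : ℝ := ε ^ 2 * (Real.sqrt (ε ^ 2 + ‖y‖ ^ 2) ^ (n + 2))⁻¹

lemma hasDerivAt_gprof (n : ℕ) (hn : 1 ≤ n) (ε s : ℝ) (h : 0 < ε ^ 2 + s) :
    HasDerivAt (gprof n ε) (-(1 / 2) * (Real.sqrt (ε ^ 2 + s) ^ (n + 2))⁻¹) s := by
  have hs : 0 < Real.sqrt (ε ^ 2 + s) := Real.sqrt_pos.2 h
  have h1 : HasDerivAt (fun s => ε ^ 2 + s) 1 s := (hasDerivAt_id s).const_add _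
  have h2 := ((((h1.sqrt h.ne').pow n).inv (pow_pos hs n).ne')).const_mul ((n : ℝ)⁻¹)
  refine h2.congr_deriv ?_
  have hn0 : (n : ℝ) ≠ 0 := by positivity
  obtain ⟨m, rfl⟩ : ∃ m, n = m + 1 := ⟨n - 1, by omega⟩
  simp only [Nat.add_sub_cancel, Pi.pow_apply]
  field_simp
  ring

lemma contDiff_Fe (n : ℕ) (ε : ℝ) (hε : 0 < ε) : ContDiff ℝ 1 (Fe n ε) := by
  unfold Fe gprof
  have h : ∀ y : Euc n, 0 < ε ^ 2 + ‖y‖ ^ 2 := fun y => by positivity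
  have h1 : ContDiff ℝ 1 fun y : Euc n => Real.sqrt (ε ^ 2 + ‖y‖ ^ 2) :=
    (contDiff_const.add (contDiff_norm_sq ℝ)).sqrt fun y => (h y).ne'
  have h2 : ContDiff ℝ 1 fun y : Euc n => (Real.sqrt (ε ^ 2 + ‖y‖ ^ 2) ^ n)⁻¹ :=
    (h1.pow n).inv fun y => (pow_pos (Real.sqrt_pos.2 (h y)) n).ne'
  exact (contDiff_const.mul h2).smul contDiff_id

lemma trace_toMat_smulRight (n : ℕ) (ℓ : Euc n →L[ℝ] ℝ) (y : Euc n) :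
    (toMat n (ℓ.smulRight y)).trace = ℓ y := by
  have : y = ∑ i, y i • EuclideanSpace.single i (1 : ℝ) := by
    ext j
    simp [Finset.sum_apply, Pi.single_apply]
  conv_rhs => rw [this]
  simp [toMat, Matrix.trace, mul_comm]

lemma fderiv_Fe_trace (n : ℕ) (hn : 1 ≤ n) (ε : ℝ) (hε : 0 < ε) (y : Euc n) :
    (toMat n (fderiv ℝ (Fe n ε) y)).trace = fe n ε y := by
  have hp : 0 < ε ^ 2 + ‖y‖ ^ 2 := by positivity
  have h1 : HasFDerivAt (fun y : Euc n => ‖y‖ ^ 2) (2 • innerSL ℝ y) y :=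
    (hasStrictFDerivAt_norm_sq y).hasFDerivAt
  have h2 := (hasDerivAt_gprof n hn ε _ hp).comp_hasFDerivAt y h1
  have h3 := h2.smul (hasFDerivAt_id y)
  have h4 : fderiv ℝ (Fe n ε) y = _ := h3.fderiv
  rw [h4, toMat_add, Matrix.trace_add]
  have hn0 : (n : ℝ) ≠ 0 := by positivity
  have hs : 0 < Real.sqrt (ε ^ 2 + ‖y‖ ^ 2) := Real.sqrt_pos.2 hp
  have e2 := trace_toMat_smulRight n ((-(1 / 2) * (Real.sqrt (ε ^ 2 + ‖y‖ ^ 2) ^ (n + 2))⁻¹) • (2 • innerSL ℝ y)) y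
  have e3 : (Function.comp (gprof n ε) (fun y : Euc n => ‖y‖ ^ 2)) y = gprof n ε (‖y‖ ^ 2) := rfl
  rw [toMat_smul, toMat_id, Matrix.trace_smul, Matrix.trace_one, Fintype.card_fin]
  simp only [id]
  rw [e2, e3]
  simp only [smul_apply, innerSL_apply_apply, real_inner_self_eq_norm_sq,
    fe, gprof, smul_eq_mul, nsmul_eq_mul]
  have hsq : Real.sqrt (ε ^ 2 + ‖y‖ ^ 2) ^ 2 = ε ^ 2 + ‖y‖ ^ 2 := Real.sq_sqrt hp.le
  field_simp
  push_cast
  linear_combination 2 * Real.sqrt (ε ^ 2 + ‖y‖ ^ 2) ^ n * hsq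

lemma toMat_product (n : ℕ) (c : ℝ) (D L : Euc n →L[ℝ] Euc n) (ℓ : Euc n →L[ℝ] ℝ) (v : Euc n) :
    (toMat n (c • (D ∘L L) + ℓ.smulRight v) * (toMat n L).adjugate).trace
      = c * ((toMat n D).trace * (toMat n L).det)
        + ∑ i, (toMat n L).adjugate.mulVec (fun j => v j) i * ℓ (EuclideanSpace.single i 1) := by
  rw [toMat_add, toMat_smul, toMat_comp, add_mul, Matrix.trace_add, smul_mul_assoc, mul_assoc,
    Matrix.mul_adjugate, Matrix.trace_smul, Matrix.mul_smul, Matrix.trace_smul, mul_one]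
  congr 1
  · simp [mul_comm]
  · simp only [Matrix.trace, Matrix.diag, Matrix.mul_apply, Matrix.mulVec, dotProduct,
      Finset.sum_mul]
    rw [Finset.sum_comm]
    refine Finset.sum_congr rfl fun i _ => Finset.sum_congr rfl fun j _ => ?_
    simp [toMat]
    ring

lemma continuous_fe (n : ℕ) (ε : ℝ) (hε : 0 < ε) : Continuous (fe n ε) := by
  unfold fe
  have h : ∀ y : Euc n, 0 < ε ^ 2 + ‖y‖ ^ 2 := fun y => by positivity
  refine continuous_const.mul (Continuous.inv₀ (by fun_prop) fun y => ?_)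
  exact (pow_pos (Real.sqrt_pos.2 (h y)) _).ne'

lemma regularised_identity (n : ℕ) (hn : 1 ≤ n) (ε : ℝ) (hε : 0 < ε) (θ : Euc n → Euc n)
    (ψ : Euc n → ℝ) (hθ : ContDiff ℝ 1 θ) (hθc : HasCompactSupport θ) (hψ : ContDiff ℝ 1 ψ)
    (hψc : HasCompactSupport ψ) :
    -∫ x, ∑ i, (toMat n (fderiv ℝ θ x)).adjugate.mulVec (fun j => Fe n ε (θ x) j) i
        * fderiv ℝ ψ x (EuclideanSpace.single i 1)
      = ∫ x, ψ x * (fe n ε (θ x) * (toMat n (fderiv ℝ θ x)).det) := by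
  set B : Set (Euc n) := tsupport θ ∪ tsupport ψ with hBdef
  have hB : IsCompact B := hθc.isCompact.union hψc.isCompact
  have hF : ContDiff ℝ 1 fun x => Fe n ε (θ x) := (contDiff_Fe n ε hε).comp hθ
  have hφ : ContDiff ℝ 1 fun x => ψ x • Fe n ε (θ x) := hψ.smul hF
  have hφc : HasCompactSupport fun x => ψ x • Fe n ε (θ x) := hψc.smul_right
  have h := weak_piola n hn θ (fun x => ψ x • Fe n ε (θ x)) hθ hθc hφ hφc B hB
    Set.subset_union_left
    ((tsupport_smul_subset_left ψ (fun x => Fe n ε (θ x))).trans Set.subset_union_right)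
  have hM := continuous_jac n θ hθ
  have e : ∀ x, (toMat n (fderiv ℝ (fun x => ψ x • Fe n ε (θ x)) x) *
      (toMat n (fderiv ℝ θ x)).adjugate).trace
      = ψ x * (fe n ε (θ x) * (toMat n (fderiv ℝ θ x)).det)
        + ∑ i, (toMat n (fderiv ℝ θ x)).adjugate.mulVec (fun j => Fe n ε (θ x) j) i
        * fderiv ℝ ψ x (EuclideanSpace.single i 1) := by
    intro x
    have h1 := (hψ.differentiable one_ne_zero x).hasFDerivAt
    have h2 := (hθ.differentiable one_ne_zero x).hasFDerivAt
    have h3 := ((contDiff_Fe n ε hε).differentiable one_ne_zero (θ x)).hasFDerivAt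
    have h4 := h1.smul (h3.comp x h2)
    have h5 : fderiv ℝ (fun x => ψ x • Fe n ε (θ x)) x = _ := h4.fderiv
    rw [h5]
    have h6 := toMat_product n (ψ x) (fderiv ℝ (Fe n ε) (θ x)) (fderiv ℝ θ x) (fderiv ℝ ψ x)
      (Fe n ε (θ x))
    rw [fderiv_Fe_trace n hn ε hε] at h6
    exact h6
  simp_rw [e] at h
  have i1 : Continuous fun x => ψ x * (fe n ε (θ x) * (toMat n (fderiv ℝ θ x)).det) :=
    hψ.continuous.mul (((continuous_fe n ε hε).comp hθ.continuous).mul hM.matrix_det)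
  have i2 : Continuous fun x => ∑ i, (toMat n (fderiv ℝ θ x)).adjugate.mulVec
      (fun j => Fe n ε (θ x) j) i * fderiv ℝ ψ x (EuclideanSpace.single i 1) := by
    refine continuous_finsetSum _ fun i _ => ?_
    refine Continuous.mul ?_ ?_
    · have hv : Continuous fun x => fun j => Fe n ε (θ x) j :=
        continuous_pi fun j => (EuclideanSpace.proj (𝕜 := ℝ) j).continuous.comp hF.continuous
      exact (continuous_apply i).comp (hM.matrix_adjugate.matrix_mulVec hv)
    · exact (hψ.continuous_fderiv one_ne_zero).clm_apply continuous_const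
  rw [integral_add (i1.continuousOn.integrableOn_compact hB)
    (i2.continuousOn.integrableOn_compact hB)] at h
  have hz : ∀ x, x ∉ B → ψ x = 0 ∧ fderiv ℝ ψ x = 0 := by
    intro x hx
    have hx' : x ∉ tsupport ψ := fun h => hx (Or.inr h)
    exact ⟨image_eq_zero_of_notMem_tsupport hx', fderiv_of_notMem_tsupport ℝ hx'⟩
  rw [setIntegral_eq_integral_of_forall_compl_eq_zero fun x hx => by simp [(hz x hx).1],
    setIntegral_eq_integral_of_forall_compl_eq_zero fun x hx => by simp [(hz x hx).2]] at h
  linarith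


/-! ### Concentration of the regularised Dirac masses -/

lemma fe_nonneg (n : ℕ) (ε : ℝ) (y : Euc n) : 0 ≤ fe n ε y := by
  unfold fe; positivity

lemma fe_scale (n : ℕ) (ε : ℝ) (hε : 0 < ε) (y : Euc n) :
    ε ^ n * fe n ε y = fe n 1 (ε⁻¹ • y) := by
  have h : Real.sqrt (ε ^ 2 + ‖y‖ ^ 2) = ε * Real.sqrt (1 ^ 2 + ‖ε⁻¹ • y‖ ^ 2) := by
    rw [norm_smul, norm_inv, Real.norm_of_nonneg hε.le]
    have : ε ^ 2 + ‖y‖ ^ 2 = ε ^ 2 * (1 ^ 2 + (ε⁻¹ * ‖y‖) ^ 2) := by field_simp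
    rw [this, Real.sqrt_mul (by positivity), Real.sqrt_sq hε.le]
  unfold fe
  rw [h]
  have : 0 < Real.sqrt (1 ^ 2 + ‖ε⁻¹ • y‖ ^ 2) := Real.sqrt_pos.2 (by positivity)
  set q := Real.sqrt (1 ^ 2 + ‖ε⁻¹ • y‖ ^ 2)
  field_simp
  ring

lemma fe_one_anti (n : ℕ) (y z : Euc n) (h : ‖y‖ ≤ ‖z‖) : fe n 1 z ≤ fe n 1 y := by
  unfold fe
  have : 0 < Real.sqrt (1 ^ 2 + ‖y‖ ^ 2) := Real.sqrt_pos.2 (by positivity)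
  gcongr

lemma fe_one_eq (n : ℕ) (y : Euc n) :
    fe n 1 y = (1 + ‖y‖ ^ 2) ^ (-((n : ℝ) + 2) / 2) := by
  unfold fe
  have hp : (0 : ℝ) < 1 + ‖y‖ ^ 2 := by positivity
  simp only [one_pow, one_mul]
  rw [Real.sqrt_eq_rpow, ← Real.rpow_natCast _ (n + 2), ← Real.rpow_mul (by positivity),
    ← Real.rpow_neg (by positivity)]
  congr 1
  push_cast
  ring

lemma integrable_fe_one (n : ℕ) : Integrable (fe n 1) := by
  have h := integrable_rpow_neg_one_add_norm_sq (E := Euc n) (μ := volume) (r := (n : ℝ) + 2)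
    (by rw [finrank_euclideanSpace_fin]; linarith)
  refine h.congr (Eventually.of_forall fun y => ?_)
  exact (fe_one_eq n y).symm

lemma radial_tendsto : Tendsto (fun r : ℝ => r * (Real.sqrt (1 ^ 2 + r ^ 2))⁻¹) atTop (𝓝 1) := by
  have h1 : Tendsto (fun r : ℝ => (Real.sqrt ((r⁻¹) ^ 2 + 1))⁻¹) atTop (𝓝 1) := by
    have h2 : ContinuousAt (fun s : ℝ => (Real.sqrt (s ^ 2 + 1))⁻¹) 0 := by
      refine ContinuousAt.inv₀ (by fun_prop) (by simp)
    have h3 := h2.tendsto.comp tendsto_inv_atTop_zero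
    simpa [Function.comp_def] using h3
  refine h1.congr' ?_
  filter_upwards [eventually_gt_atTop 0] with r hr
  have : 1 ^ 2 + r ^ 2 = r ^ 2 * ((r⁻¹) ^ 2 + 1) := by field_simp
  rw [this, Real.sqrt_mul (by positivity), Real.sqrt_sq hr.le]
  field_simp

lemma integral_fe_one (n : ℕ) (hn : 1 ≤ n) : ∫ y, fe n 1 y = ballVol n := by
  have : Nonempty (Fin n) := ⟨⟨0, hn⟩⟩
  have hn0 : (n : ℝ) ≠ 0 := by positivity
  set f : ℝ → ℝ := fun r => (Real.sqrt (1 ^ 2 + r ^ 2) ^ (n + 2))⁻¹ with hf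
  have e : ∫ y : Euc n, fe n 1 y = ∫ y : Euc n, f ‖y‖ := by
    congr 1; ext y; simp [fe, hf]
  rw [e, integral_fun_norm_addHaar, finrank_euclideanSpace_fin]
  have h : ∫ r in Set.Ioi (0 : ℝ), (n : ℝ) * (r ^ (n - 1) * f r)
      = 1 - (fun r : ℝ => (n : ℝ) * (gprof n 1 (r ^ 2) * r ^ n)) 0 := by
    refine integral_Ioi_of_hasDerivAt_of_nonneg'
      (g := fun r : ℝ => (n : ℝ) * (gprof n 1 (r ^ 2) * r ^ n)) ?_ ?_ ?_
    · intro r _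
      have hp : 0 < (1 : ℝ) ^ 2 + r ^ 2 := by positivity
      have h1 : HasDerivAt (fun r : ℝ => r ^ 2) (2 * r) r := by
        simpa using hasDerivAt_pow 2 r
      have h0 : HasDerivAt (gprof n 1) _ ((fun r : ℝ => r ^ 2) r) :=
        hasDerivAt_gprof n hn 1 _ hp
      have h2 := ((HasDerivAt.comp (h := fun r : ℝ => r ^ 2) r h0 h1).mul (hasDerivAt_pow n r)).const_mul
        (n : ℝ)
      refine h2.congr_deriv ?_
      have hs : 0 < Real.sqrt (1 ^ 2 + r ^ 2) := Real.sqrt_pos.2 hp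
      have hsq : Real.sqrt (1 ^ 2 + r ^ 2) ^ 2 = 1 ^ 2 + r ^ 2 := Real.sq_sqrt hp.le
      simp only [hf, gprof, Function.comp]
      obtain ⟨m, rfl⟩ : ∃ m, n = m + 1 := ⟨n - 1, by omega⟩
      simp only [Nat.add_sub_cancel]
      set q := Real.sqrt (1 ^ 2 + r ^ 2)
      field_simp
      linear_combination r ^ m * q ^ (m + 1) * hsq
    · intro r hr
      have : (0 : ℝ) < r := hr
      simp only [hf]
      positivity
    · refine (radial_tendsto.pow n).congr' ?_ |>.trans (by simp)
      filter_upwards with r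
      rw [gprof, mul_pow, inv_pow]
      field_simp
  have h0 : (0 : ℝ) ^ n = 0 := zero_pow (by omega)
  rw [integral_const_mul] at h
  simp only [h0, mul_zero, sub_zero] at h
  simp only [smul_eq_mul, nsmul_eq_mul]
  rw [mul_left_comm, h, mul_one]
  rfl

lemma integral_fe_linear (n : ℕ) (hn : 1 ≤ n) (A : Euc n →L[ℝ] Euc n) (hA : A.det ≠ 0) :
    ∫ y, fe n 1 (A y) = |A.det|⁻¹ * ballVol n := by
  have hA' : LinearMap.det (A : Euc n →ₗ[ℝ] Euc n) ≠ 0 := hA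
  have h := Measure.map_linearMap_addHaar_eq_smul_addHaar (μ := (volume : Measure (Euc n))) hA'
  have h2 : ∫ y, fe n 1 y ∂(Measure.map A (volume : Measure (Euc n))) = ∫ y, fe n 1 (A y) :=
    integral_map A.continuous.aemeasurable
      (continuous_fe n 1 one_pos).aestronglyMeasurable
  rw [← h2]
  have h3 : Measure.map A (volume : Measure (Euc n))
    = ENNReal.ofReal |(LinearMap.det (A : Euc n →ₗ[ℝ] Euc n))⁻¹| • volume := h
  rw [h3, integral_smul_measure, integral_fe_one n hn, ENNReal.toReal_ofReal (abs_nonneg _),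
    abs_inv]
  rfl

lemma local_limit (n : ℕ) (hn : 1 ≤ n) (w : Euc n → Euc n) (hw : Continuous w) (z : Euc n)
    (N : Set (Euc n)) (hN : IsOpen N) (hz : z ∈ N) (k : Euc n → ℝ) (hk : Continuous k)
    (K : ℝ) (hK : ∀ x, ‖k x‖ ≤ K) (hwz : w z = 0) (A : Euc n →L[ℝ] Euc n)
    (hA : HasFDerivAt w A z) (hdet : A.det ≠ 0) (c : ℝ) (hc : 0 < c)
    (hlow : ∀ x ∈ N, c * ‖x - z‖ ≤ ‖w x‖) :
    Tendsto (fun ε => ∫ x in N, k x * fe n ε (w x)) (𝓝[>] 0)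
      (𝓝 (k z * (|A.det|⁻¹ * ballVol n))) := by
  have hpos : ∀ᶠ ε : ℝ in 𝓝[>] 0, 0 < ε := eventually_mem_nhdsWithin
  have key : ∀ᶠ ε : ℝ in 𝓝[>] 0,
      ∫ y, N.indicator (fun x => k x * fe n 1 (ε⁻¹ • w x)) (z + ε • y)
        = ∫ x in N, k x * fe n ε (w x) := by
    filter_upwards [hpos] with ε hε
    rw [Measure.integral_comp_smul volume
      (fun y => N.indicator (fun x => k x * fe n 1 (ε⁻¹ • w x)) (z + y)),
      integral_add_left_eq_self (fun y => N.indicator (fun x => k x * fe n 1 (ε⁻¹ • w x)) y),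
      integral_indicator hN.measurableSet, finrank_euclideanSpace_fin,
      abs_of_pos (by positivity), smul_eq_mul, ← integral_const_mul]
    congr 1
    ext x
    rw [← fe_scale n ε hε]
    field_simp
  refine Tendsto.congr' key ?_
  rw [← integral_fe_linear n hn A hdet, ← integral_const_mul]
  refine tendsto_integral_filter_of_dominated_convergence (fun y => K * fe n 1 (c • y)) ?_ ?_ ?_ ?_
  · filter_upwards [hpos] with ε hε
    have h0 : Continuous fun x => ε⁻¹ • w x := (continuous_const_smul ε⁻¹).comp hw
    have h00 : Continuous fun x => fe n 1 (ε⁻¹ • w x) := (continuous_fe n 1 one_pos).comp h0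
    have h000 : Continuous fun x => k x * fe n 1 (ε⁻¹ • w x) := hk.mul h00
    have h1 : Measurable (N.indicator (fun x => k x * fe n 1 (ε⁻¹ • w x))) :=
      h000.measurable.indicator hN.measurableSet
    exact (h1.comp (by fun_prop : Measurable fun y : Euc n => z + ε • y)).aestronglyMeasurable
  · filter_upwards [hpos] with ε hε
    refine Eventually.of_forall fun y => ?_
    have hK0 : 0 ≤ K := (norm_nonneg _).trans (hK z)
    by_cases hy : z + ε • y ∈ N
    · rw [Set.indicator_of_mem hy, norm_mul, Real.norm_of_nonneg (fe_nonneg n 1 _)]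
      refine mul_le_mul (hK _) (fe_one_anti n _ _ ?_) (fe_nonneg n 1 _) hK0
      have := hlow _ hy
      rw [add_sub_cancel_left, norm_smul, Real.norm_of_nonneg hε.le] at this
      rw [norm_smul, norm_smul, norm_inv, Real.norm_of_nonneg hε.le, Real.norm_of_nonneg hc.le,
        le_inv_mul_iff₀ hε]
      linarith
    · rw [Set.indicator_of_notMem hy, norm_zero]
      exact mul_nonneg hK0 (fe_nonneg n 1 _)
  · exact ((integrable_fe_one n).comp_smul hc.ne').const_mul K
  · refine Eventually.of_forall fun y => ?_
    have t0 : Tendsto (fun ε : ℝ => z + ε • y) (𝓝[>] 0) (𝓝 z) := by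
      have : Continuous fun ε : ℝ => z + ε • y := by fun_prop
      have h := this.tendsto 0
      simp only [zero_smul, add_zero] at h
      exact h.mono_left nhdsWithin_le_nhds
    have t1 : Tendsto (fun ε : ℝ => ε⁻¹ • w (z + ε • y)) (𝓝[>] 0) (𝓝 (A y)) := by
      have := (hA.hasLineDerivAt y).tendsto_slope_zero_right
      simpa [hwz] using this
    have t2 : Tendsto (fun ε : ℝ => k (z + ε • y) * fe n 1 (ε⁻¹ • w (z + ε • y))) (𝓝[>] 0)
        (𝓝 (k z * fe n 1 (A y))) :=
      ((hk.tendsto z).comp t0).mul (((continuous_fe n 1 one_pos).tendsto _).comp t1)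
    refine t2.congr' ?_
    filter_upwards [t0.eventually (hN.mem_nhds hz)] with ε hε
    rw [Set.indicator_of_mem hε]

/-! ### The vector field `j u^a` -/

lemma adj_rank_one (n : ℕ) (v : Fin n → ℝ) (hv : v ⬝ᵥ v = 1) :
    (1 - Matrix.vecMulVec v v).adjugate.mulVec v = v := by
  let M : ℝ → Matrix (Fin n) (Fin n) ℝ := fun t => 1 - t • Matrix.vecMulVec v v
  have hM : Continuous M := by
    exact continuous_const.sub (continuous_id.smul continuous_const)
  have hMv : ∀ t, (M t).mulVec v = (1 - t) • v := by
    intro t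
    simp only [M, Matrix.sub_mulVec, Matrix.one_mulVec, Matrix.smul_mulVec,
      Matrix.vecMulVec_mulVec, hv, sub_smul, one_smul]
    simp
  have hdet : ∀ t, (M t).det = 1 - t := by
    intro t
    have := Matrix.det_one_add_replicateCol_mul_replicateRow (ι := Unit) (-t • v) v
    rw [← Matrix.vecMulVec_eq] at this
    simp only [dotProduct_smul, hv, Matrix.smul_vecMulVec] at this
    simp only [M]
    rw [sub_eq_add_neg, ← neg_smul, this]
    simp [sub_eq_add_neg]
  have key : ∀ t, t ≠ 1 → (M t).adjugate.mulVec v = v := by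
    intro t ht
    have h1 : (M t).adjugate.mulVec ((M t).mulVec v) = (1 - t) • v := by
      rw [Matrix.mulVec_mulVec, Matrix.adjugate_mul, hdet, Matrix.smul_mulVec, Matrix.one_mulVec]
    rw [hMv, Matrix.mulVec_smul] at h1
    exact smul_right_injective _ (sub_ne_zero.2 (Ne.symm ht)) h1
  have hc : Continuous fun t => (M t).adjugate.mulVec v :=
    hM.matrix_adjugate.matrix_mulVec continuous_const
  have hd : Dense {t : ℝ | t ≠ 1} := dense_compl_singleton 1
  have := hc.ext_on hd continuous_const (fun t ht => key t ht)
  have h2 := congrFun this 1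
  simpa [M] using h2

lemma gprof_one_zero (s : ℝ) (hs : 0 ≤ s) : gprof 1 0 (s ^ 2) = s⁻¹ := by
  simp [gprof, Real.sqrt_sq hs]

lemma Fe_zero (n : ℕ) (y : Euc n) : Fe n 0 y = ((n : ℝ)⁻¹ * (‖y‖ ^ n)⁻¹) • y := by
  simp [Fe, gprof, Real.sqrt_sq (norm_nonneg y)]

lemma hasFDerivAt_dir (n : ℕ) (y : Euc n) (hy : y ≠ 0) :
    ∃ D : Euc n →L[ℝ] Euc n, HasFDerivAt (fun y : Euc n => ‖y‖⁻¹ • y) D y ∧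
      toMat n D = ‖y‖⁻¹ • (1 - Matrix.vecMulVec (fun i => (‖y‖⁻¹ • y) i)
        (fun i => (‖y‖⁻¹ • y) i)) := by
  have hr : 0 < ‖y‖ := norm_pos_iff.2 hy
  have hp : 0 < (0 : ℝ) ^ 2 + ‖y‖ ^ 2 := by positivity
  have h1 : HasFDerivAt (fun y : Euc n => ‖y‖ ^ 2) (2 • innerSL ℝ y) y :=
    (hasStrictFDerivAt_norm_sq y).hasFDerivAt
  have h2 := (hasDerivAt_gprof 1 le_rfl 0 _ hp).comp_hasFDerivAt y h1
  have h3 := h2.smul (hasFDerivAt_id y)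
  have e : (fun y : Euc n => ‖y‖⁻¹ • y) =
      (fun y : Euc n => (Function.comp (gprof 1 0) (fun y : Euc n => ‖y‖ ^ 2)) y • id y) := by
    funext y
    simp only [Function.comp, id, gprof_one_zero _ (norm_nonneg y)]
  refine ⟨_, by rw [e]; exact h3, ?_⟩
  ext i j
  simp only [toMat_add, toMat_smul, toMat_id, Function.comp, gprof_one_zero _ (norm_nonneg y)]
  simp only [toMat, Matrix.add_apply, Matrix.smul_apply, Matrix.sub_apply, Matrix.of_apply,
    Matrix.vecMulVec_apply, ContinuousLinearMap.smulRight_apply, smul_apply, id,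
    innerSL_apply_apply, PiLp.smul_apply, smul_eq_mul, nsmul_eq_mul,
    EuclideanSpace.inner_single_right, zero_pow two_ne_zero, zero_add, Real.sqrt_sq (norm_nonneg y),
    ne_eq, OfNat.ofNat_ne_zero, not_false_eq_true]
  simp
  field_simp
  ring

lemma jvec_proj (n : ℕ) (hn : 1 ≤ n) (u : Euc n → Euc n) (a x : Euc n)
    (hu : DifferentiableAt ℝ u x) (hx : u x ≠ a) :
    jvec n (proj n u a) x =
      (jacMat n u x).adjugate.mulVec (fun j => Fe n 0 (u x - a) j) := by
  have hy : u x - a ≠ 0 := sub_ne_zero.2 hx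
  have hr : 0 < ‖u x - a‖ := norm_pos_iff.2 hy
  obtain ⟨D, hD, hDm⟩ := hasFDerivAt_dir n (u x - a) hy
  have hw : HasFDerivAt (fun x => u x - a) (fderiv ℝ u x) x := hu.hasFDerivAt.sub_const a
  have hP : HasFDerivAt (proj n u a) (D ∘L fderiv ℝ u x) x :=
    HasFDerivAt.comp x (g := fun y : Euc n => ‖y‖⁻¹ • y) hD hw
  have hj : jacMat n (proj n u a) x = toMat n D * toMat n (fderiv ℝ u x) := by
    rw [jacMat_eq, hP.fderiv, toMat_comp]
  set v : Fin n → ℝ := fun i => (‖u x - a‖⁻¹ • (u x - a)) i with hvdef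
  have hv : v ⬝ᵥ v = 1 := by
    have h1 : ‖(‖u x - a‖⁻¹ • (u x - a) : Euc n)‖ ^ 2 = 1 := by
      rw [norm_smul, norm_inv, norm_norm, inv_mul_cancel₀ hr.ne', one_pow]
    rw [EuclideanSpace.norm_sq_eq] at h1
    rw [← h1]
    refine Finset.sum_congr rfl fun i _ => ?_
    rw [Real.norm_eq_abs, sq_abs, sq]
  have hF : (fun j => Fe n 0 (u x - a) j)
      = ((n : ℝ)⁻¹ * (‖u x - a‖⁻¹) ^ (n - 1)) • v := by
    funext j
    rw [Fe_zero]
    simp only [hvdef, Pi.smul_apply, PiLp.smul_apply, smul_eq_mul]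
    obtain ⟨m, rfl⟩ : ∃ m, n = m + 1 := ⟨n - 1, by omega⟩
    simp only [Nat.add_sub_cancel, pow_succ, mul_inv, inv_pow]
    ring
  rw [hF, jacMat_eq]
  funext i
  unfold jvec
  rw [hj, hDm, Matrix.adjugate_mul_distrib, Matrix.adjugate_smul]
  have : (fun j => proj n u a x j) = v := rfl
  rw [this, ← Matrix.mulVec_mulVec, Matrix.smul_mulVec, adj_rank_one n v hv, Matrix.mulVec_smul,
    Matrix.mulVec_smul, Fintype.card_fin]
  simp only [Pi.smul_apply, smul_eq_mul]
  ring

lemma lower_bound (n : ℕ) (w : Euc n → Euc n) (z : Euc n) (hwz : w z = 0)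
    (A : Euc n →L[ℝ] Euc n) (hA : HasFDerivAt w A z) (hdet : A.det ≠ 0) :
    ∃ c > 0, ∀ᶠ x in 𝓝 z, c * ‖x - z‖ ≤ ‖w x‖ := by
  let e := A.toContinuousLinearEquivOfDetNeZero hdet
  have hind : Topology.IsInducing A := e.toHomeomorph.isInducing
  have h := (hA.isTheta_sub hind).2
  obtain ⟨C, hC, hb⟩ := h.exists_pos
  refine ⟨C⁻¹, inv_pos.2 hC, ?_⟩
  filter_upwards [hb.bound] with x hx
  rw [hwz, sub_zero] at hx
  rw [inv_mul_le_iff₀ hC]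
  exact hx

/-! ### Global concentration limit -/

lemma fe_le (n : ℕ) (ε m : ℝ) (hm : 0 < m) (y : Euc n) (hy : m ≤ ‖y‖) :
    fe n ε y ≤ ε ^ 2 * (m ^ (n + 2))⁻¹ := by
  unfold fe
  have h1 : m ≤ Real.sqrt (ε ^ 2 + ‖y‖ ^ 2) := by
    refine Real.le_sqrt_of_sq_le ?_
    nlinarith [sq_nonneg ε]
  gcongr

lemma global_limit (n : ℕ) (hn : 1 ≤ n) (w : Euc n → Euc n) (hw : Continuous w)
    (k : Euc n → ℝ) (hk : Continuous k) (hkc : HasCompactSupport k) (Z : Finset (Euc n))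
    (hZ : ∀ x ∈ tsupport k, w x = 0 → x ∈ Z) (A : Euc n → Euc n →L[ℝ] Euc n)
    (hwz : ∀ z ∈ Z, w z = 0) (hA : ∀ z ∈ Z, HasFDerivAt w (A z) z)
    (hdet : ∀ z ∈ Z, (A z).det ≠ 0) :
    Tendsto (fun ε => ∫ x, k x * fe n ε (w x)) (𝓝[>] 0)
      (𝓝 (∑ z ∈ Z, k z * (|(A z).det|⁻¹ * ballVol n))) := by
  classical
  have hlb : ∀ z ∈ Z, ∃ c > 0, ∀ᶠ x in 𝓝 z, c * ‖x - z‖ ≤ ‖w x‖ := fun z hz =>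
    lower_bound n w z (hwz z hz) (A z) (hA z hz) (hdet z hz)
  choose! c hc0 hc using hlb
  obtain ⟨U, hU, hUd⟩ := (Z.finite_toSet).t2_separation
  let N : Euc n → Set (Euc n) := fun z => U z ∩ interior {x | c z * ‖x - z‖ ≤ ‖w x‖}
  have hNo : ∀ z, IsOpen (N z) := fun z => (hU z).2.inter isOpen_interior
  have hNz : ∀ z ∈ Z, z ∈ N z := fun z hz => ⟨(hU z).1, mem_interior_iff_mem_nhds.2 (hc z hz)⟩
  have hNb : ∀ z, ∀ x ∈ N z, c z * ‖x - z‖ ≤ ‖w x‖ := by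
    intro z x hx
    have h := interior_subset hx.2
    exact h
  have hNd : (Z : Set (Euc n)).PairwiseDisjoint N := fun x hx y hy hxy =>
    (hUd hx hy hxy).mono Set.inter_subset_left Set.inter_subset_left
  let W : Set (Euc n) := ⋃ z ∈ Z, N z
  have hWo : IsOpen W := isOpen_biUnion fun z _ => hNo z
  have hInt : ∀ ε, 0 < ε → Integrable (fun x => k x * fe n ε (w x)) := fun ε hε =>
    (hk.mul ((continuous_fe n ε hε).comp hw)).integrable_of_hasCompactSupport hkc.mul_right
  obtain ⟨K, hK⟩ := hk.bounded_above_of_compact_support hkc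
  have hsplit : ∀ ε, 0 < ε → ∫ x, k x * fe n ε (w x) =
      ∑ z ∈ Z, (∫ x in N z, k x * fe n ε (w x)) + ∫ x in Wᶜ, k x * fe n ε (w x) := by
    intro ε hε
    rw [← integral_add_compl hWo.measurableSet (hInt ε hε),
      integral_biUnion_finset Z (fun z _ => (hNo z).measurableSet) hNd
        (fun z _ => (hInt ε hε).integrableOn)]
  have hloc : Tendsto (fun ε => ∑ z ∈ Z, (∫ x in N z, k x * fe n ε (w x))) (𝓝[>] 0)
      (𝓝 (∑ z ∈ Z, k z * (|(A z).det|⁻¹ * ballVol n))) :=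
    tendsto_finsetSum _ fun z hz => local_limit n hn w hw z (N z) (hNo z) (hNz z hz) k hk K hK
      (hwz z hz) (A z) (hA z hz) (hdet z hz) (c z) (hc0 z hz) (hNb z)
  have hm : ∃ m > 0, ∀ x ∈ tsupport k \ W, m ≤ ‖w x‖ := by
    have hKc : IsCompact (tsupport k \ W) := IsCompact.diff hkc hWo
    rcases (tsupport k \ W).eq_empty_or_nonempty with he | hne
    · exact ⟨1, one_pos, fun x hx => by rw [he] at hx; exact hx.elim⟩
    · obtain ⟨x0, hx0, hmin⟩ := hKc.exists_isMinOn hne (hw.norm.continuousOn)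
      refine ⟨‖w x0‖, norm_pos_iff.2 fun h => ?_, fun x hx => hmin hx⟩
      have := hZ x0 hx0.1 h
      exact hx0.2 (Set.mem_biUnion this (hNz x0 this))
  obtain ⟨m, hm0, hm⟩ := hm
  have hrest : Tendsto (fun ε => ∫ x in Wᶜ, k x * fe n ε (w x)) (𝓝[>] 0) (𝓝 0) := by
    have hki : Integrable fun x => ‖k x‖ := (hk.integrable_of_hasCompactSupport hkc).norm
    have hb : ∀ ε, 0 < ε → ‖∫ x in Wᶜ, k x * fe n ε (w x)‖ ≤
        ε ^ 2 * ((m ^ (n + 2))⁻¹ * ∫ x in Wᶜ, ‖k x‖) := by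
      intro ε hε
      rw [← mul_assoc, ← integral_const_mul]
      refine norm_integral_le_of_norm_le (hki.integrableOn.const_mul _) ?_
      refine (ae_restrict_iff' hWo.measurableSet.compl).2 (Eventually.of_forall fun x hx => ?_)
      rw [norm_mul, mul_comm]
      by_cases hxk : x ∈ tsupport k
      · refine mul_le_mul_of_nonneg_right ?_ (norm_nonneg _)
        rw [Real.norm_of_nonneg (fe_nonneg _ _ _)]
        exact fe_le n ε m hm0 _ (hm x ⟨hxk, hx⟩)
      · rw [image_eq_zero_of_notMem_tsupport hxk]
        simp
    refine squeeze_zero_norm' ?_ (?_ : Tendsto (fun ε : ℝ =>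
      ε ^ 2 * ((m ^ (n + 2))⁻¹ * ∫ x in Wᶜ, ‖k x‖)) _ _)
    · filter_upwards [self_mem_nhdsWithin] with ε hε using hb ε hε
    · have : Tendsto (fun ε : ℝ => ε ^ 2 * ((m ^ (n + 2))⁻¹ * ∫ x in Wᶜ, ‖k x‖)) (𝓝 0)
          (𝓝 (0 ^ 2 * ((m ^ (n + 2))⁻¹ * ∫ x in Wᶜ, ‖k x‖))) :=
        (Continuous.tendsto (by fun_prop) 0)
      rw [zero_pow two_ne_zero, zero_mul] at this
      exact this.mono_left nhdsWithin_le_nhds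
  have := hloc.add hrest
  rw [add_zero] at this
  refine this.congr' ?_
  filter_upwards [self_mem_nhdsWithin] with ε hε using (hsplit ε hε).symm

/-! ### Finiteness of the zero set -/

lemma zeros_finite (n : ℕ) (w : Euc n → Euc n) (C S : Set (Euc n)) (hC : IsCompact C)
    (hw : ContinuousOn w C) (hS : S = {x ∈ C | w x = 0})
    (hA : ∀ z ∈ S, ∃ A : Euc n →L[ℝ] Euc n, HasFDerivAt w A z ∧ A.det ≠ 0) : S.Finite := by
  by_contra hinf
  have hSC : S ⊆ C := by rw [hS]; exact fun x hx => hx.1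
  obtain ⟨z, hzC, hz⟩ := Set.Infinite.exists_accPt_of_subset_isCompact hinf hC hSC
  have hz0 : w z = 0 := by
    have hcl : IsClosed S := by
      rw [hS]
      have := hw.preimage_isClosed_of_isClosed hC.isClosed (isClosed_singleton (x := (0 : Euc n)))
      convert this using 1
      ext x
      rfl
    have : z ∈ S := hcl.closure_eq ▸ hz.clusterPt.mem_closure
    rw [hS] at this
    exact this.2
  have hzS : z ∈ S := by rw [hS]; exact ⟨hzC, hz0⟩
  obtain ⟨A, hA1, hA2⟩ := hA z hzS
  obtain ⟨c, hc, hb⟩ := lower_bound n w z hz0 A hA1 hA2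
  rw [accPt_iff_frequently] at hz
  obtain ⟨x, ⟨hxz, hxS⟩, hx⟩ := (hz.and_eventually hb).exists
  rw [hS] at hxS
  rw [hxS.2, norm_zero] at hx
  have : 0 < ‖x - z‖ := norm_pos_iff.2 (sub_ne_zero.2 hxz)
  nlinarith

/-! ### Integrability of `j u^a` -/

/-- The explicit form of `j u^a`, with `w = u - a`. -/
def Jf (n : ℕ) (w : Euc n → Euc n) (x : Euc n) : Fin n → ℝ :=
  (toMat n (fderiv ℝ w x)).adjugate.mulVec (fun j => Fe n 0 (w x) j)

lemma Jf_eq (n : ℕ) (w : Euc n → Euc n) (x : Euc n) :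
    Jf n w x = ((n : ℝ)⁻¹ * (‖w x‖ ^ n)⁻¹) •
      (toMat n (fderiv ℝ w x)).adjugate.mulVec (fun j => w x j) := by
  unfold Jf
  rw [Fe_zero, ← Matrix.mulVec_smul]
  rfl

lemma integrableOn_radial (n : ℕ) (hn : 1 ≤ n) (z : Euc n) (r : ℝ) :
    IntegrableOn (fun x : Euc n => (‖x - z‖ ^ (n - 1))⁻¹) (ball z r) := by
  have : Nonempty (Fin n) := ⟨⟨0, hn⟩⟩
  have h0 : IntegrableOn (fun x : Euc n => (fun y : ℝ => (y ^ (n - 1))⁻¹) ‖x‖) (ball 0 r) := by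
    refine (integrableOn_fun_norm_addHaar (μ := (volume : Measure (Euc n)))
      (f := fun y : ℝ => (y ^ (n - 1))⁻¹) (r := r)).2 ?_
    rw [finrank_euclideanSpace_fin]
    have h1 : IntegrableOn (fun _ : ℝ => (1 : ℝ)) (Set.Ioo 0 r) := by
      refine integrableOn_const ?_
      simp
    refine h1.congr_fun ?_ measurableSet_Ioo
    intro y hy
    have : y ^ (n - 1) ≠ 0 := (pow_pos hy.1 _).ne'
    simp [this]
  have h2 := (measurePreserving_sub_right (volume : Measure (Euc n)) z).integrableOn_comp_preimage
    (measurableEmbedding_subRight z) (f := fun x : Euc n => (‖x‖ ^ (n - 1))⁻¹) (s := ball 0 r)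
  have h3 : (fun x => x - z) ⁻¹' ball (0 : Euc n) r = ball z r := by
    ext x
    simp [dist_eq_norm]
  rw [h3] at h2
  exact h2.2 h0

lemma norm_mulVec_le (n : ℕ) (B : Matrix (Fin n) (Fin n) ℝ) (v : Euc n) :
    ‖B.mulVec (fun j => v j)‖ ≤ (∑ i, ∑ j, |B i j|) * ‖v‖ := by
  refine (pi_norm_le_iff_of_nonneg (by positivity)).2 fun i => ?_
  have h1 : ‖B.mulVec (fun j => v j) i‖ ≤ (∑ j, |B i j|) * ‖v‖ := by
    rw [Matrix.mulVec, dotProduct, Finset.sum_mul]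
    refine (norm_sum_le _ _).trans (Finset.sum_le_sum fun j _ => ?_)
    rw [norm_mul, Real.norm_eq_abs]
    exact mul_le_mul_of_nonneg_left (PiLp.norm_apply_le v j) (abs_nonneg _)
  refine h1.trans (mul_le_mul_of_nonneg_right ?_ (norm_nonneg _))
  exact Finset.single_le_sum (f := fun i => ∑ j, |B i j|)
    (fun i _ => by positivity) (Finset.mem_univ i)

lemma Jf_integrableOn (n : ℕ) (hn : 1 ≤ n) (w : Euc n → Euc n) (V C : Set (Euc n))
    (hV : IsOpen V) (hw : ContDiffOn ℝ 1 w V) (hC : IsCompact C) (hCV : C ⊆ V)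
    (hreg : ∀ z ∈ C, w z = 0 → (fderiv ℝ w z).det ≠ 0) : IntegrableOn (Jf n w) C := by
  have hfd : ContinuousOn (fderiv ℝ w) V := hw.continuousOn_fderiv_of_isOpen hV le_rfl
  have hadj : ContinuousOn (fun x => (toMat n (fderiv ℝ w x)).adjugate) V :=
    (Continuous.matrix_adjugate continuous_id).comp_continuousOn
      ((continuous_toMat n).comp_continuousOn hfd)
  have hwc : ContinuousOn w V := hw.continuousOn
  have hwc2 : ContinuousOn (fun x => (fun j => w x j : Fin n → ℝ)) V :=
    (PiLp.continuous_ofLp 2 _).comp_continuousOn hwc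
  have hh : ContinuousOn (fun x => (toMat n (fderiv ℝ w x)).adjugate.mulVec (fun j => w x j)) V := by
    have : Continuous fun p : Matrix (Fin n) (Fin n) ℝ × (Fin n → ℝ) => p.1.mulVec p.2 :=
      continuous_fst.matrix_mulVec continuous_snd
    have h2 := hadj.prodMk hwc2
    have h3 := this.comp_continuousOn h2
    refine h3.congr fun x _ => ?_
    rfl
  have hmeas : AEStronglyMeasurable (Jf n w) (volume.restrict V) := by
    have e : Jf n w = fun x => ((n : ℝ)⁻¹ * (‖w x‖ ^ n)⁻¹) •
      (toMat n (fderiv ℝ w x)).adjugate.mulVec (fun j => w x j) := funext (Jf_eq n w)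
    rw [e]
    have h1 : AEStronglyMeasurable w (volume.restrict V) :=
      hwc.aestronglyMeasurable hV.measurableSet
    have h2 : AEMeasurable (fun x => (n : ℝ)⁻¹ * (‖w x‖ ^ n)⁻¹) (volume.restrict V) :=
      ((h1.norm.aemeasurable.pow_const n).inv).const_mul _
    exact h2.aestronglyMeasurable.smul (hh.aestronglyMeasurable hV.measurableSet)
  refine LocallyIntegrableOn.integrableOn_isCompact (fun z hz => ?_) hC
  refine IntegrableAtFilter.filter_mono nhdsWithin_le_nhds ?_
  have hzV : V ∈ 𝓝 z := hV.mem_nhds (hCV hz)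
  by_cases h0 : w z = 0
  · have hdiff : HasFDerivAt w (fderiv ℝ w z) z :=
      ((hw.differentiableOn one_ne_zero).differentiableAt hzV).hasFDerivAt
    obtain ⟨c, hc, hb⟩ := lower_bound n w z h0 _ hdiff (hreg z hz h0)
    have hS : ContinuousAt (fun x => ∑ i, ∑ j, |(toMat n (fderiv ℝ w x)).adjugate i j|) z := by
      have : Continuous fun B : Matrix (Fin n) (Fin n) ℝ => ∑ i, ∑ j, |B i j| :=
        continuous_finsetSum _ fun i _ => continuous_finsetSum _ fun j _ =>
          (continuous_id.matrix_elem i j).abs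
      exact this.continuousAt.comp (hadj.continuousAt hzV)
    have hSb := hS.eventually (gt_mem_nhds (lt_add_one _))
    set S := (∑ i, ∑ j, |(toMat n (fderiv ℝ w z)).adjugate i j|) + 1
    obtain ⟨r, hr, hball⟩ := Metric.mem_nhds_iff.1 (inter_mem (inter_mem hb hSb) hzV)
    refine ⟨ball z r, ball_mem_nhds z hr, ?_⟩
    refine Integrable.mono' ((integrableOn_radial n hn z r).const_mul (S * (c ^ (n - 1))⁻¹))
      (hmeas.mono_measure (Measure.restrict_mono (fun x hx => (hball hx).2) le_rfl)) ?_
    refine (ae_restrict_iff' measurableSet_ball).2 (Eventually.of_forall fun x hx => ?_)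
    obtain ⟨⟨hx1, hx2⟩, hx3⟩ := hball hx
    simp only [Set.mem_ofPred_eq] at hx1 hx2
    have hS0 : 0 ≤ S := le_trans (by positivity) hx2.le
    rcases eq_or_ne x z with rfl | hxz
    · rw [Jf_eq, h0]
      have : (fun j => (0 : Euc n) j) = (0 : Fin n → ℝ) := rfl
      rw [this, Matrix.mulVec_zero, smul_zero, norm_zero]
      positivity
    have hpos : 0 < ‖x - z‖ := norm_pos_iff.2 (sub_ne_zero.2 hxz)
    have hwpos : 0 < ‖w x‖ := lt_of_lt_of_le (by positivity) hx1
    rw [Jf_eq, norm_smul]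
    have hn1 : (n : ℝ)⁻¹ ≤ 1 := inv_le_one_of_one_le₀ (by exact_mod_cast hn)
    calc ‖(n : ℝ)⁻¹ * (‖w x‖ ^ n)⁻¹‖ * ‖(toMat n (fderiv ℝ w x)).adjugate.mulVec (fun j => w x j)‖
        ≤ (1 * (‖w x‖ ^ n)⁻¹) * (S * ‖w x‖) := by
          rw [Real.norm_of_nonneg (by positivity)]
          gcongr
          exact (norm_mulVec_le n _ _).trans (mul_le_mul_of_nonneg_right hx2.le (norm_nonneg _))
      _ = S * (‖w x‖ ^ (n - 1))⁻¹ := by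
          obtain ⟨m, rfl⟩ : ∃ m, n = m + 1 := ⟨n - 1, by omega⟩
          simp only [Nat.add_sub_cancel, pow_succ]
          field_simp
      _ ≤ S * ((c * ‖x - z‖) ^ (n - 1))⁻¹ := by gcongr
      _ = S * (c ^ (n - 1))⁻¹ * (‖x - z‖ ^ (n - 1))⁻¹ := by
          rw [mul_pow, mul_inv, mul_assoc]
  · have hcont : ContinuousOn (Jf n w) (V ∩ w ⁻¹' {0}ᶜ) := by
      have e : Jf n w = fun x => ((n : ℝ)⁻¹ * (‖w x‖ ^ n)⁻¹) •
        (toMat n (fderiv ℝ w x)).adjugate.mulVec (fun j => w x j) := funext (Jf_eq n w)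
      rw [e]
      refine ContinuousOn.smul (continuousOn_const.mul (ContinuousOn.inv₀
        ((hwc.mono Set.inter_subset_left).norm.pow n) fun x hx => ?_)) (hh.mono Set.inter_subset_left)
      exact (pow_pos (norm_pos_iff.2 hx.2) n).ne'
    have ho : IsOpen (V ∩ w ⁻¹' {0}ᶜ) := hwc.isOpen_inter_preimage hV isOpen_compl_singleton
    have := hcont.integrableAt_nhdsWithin (μ := volume) ho.measurableSet (a := z) ⟨hCV hz, h0⟩
    rwa [ho.nhdsWithin_eq ⟨hCV hz, h0⟩] at this

/-! ### Passing to the limit -/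

/-- Pairing of the regularised field with `∇ψ`. -/
def pairE (n : ℕ) (ε : ℝ) (θ : Euc n → Euc n) (ψ : Euc n → ℝ) (x : Euc n) : ℝ :=
  ∑ i, (toMat n (fderiv ℝ θ x)).adjugate.mulVec (fun j => Fe n ε (θ x) j) i *
    fderiv ℝ ψ x (EuclideanSpace.single i 1)

lemma pairE_eq (n : ℕ) (ε : ℝ) (θ : Euc n → Euc n) (ψ : Euc n → ℝ) (x : Euc n) :
    pairE n ε θ ψ x = gprof n ε (‖θ x‖ ^ 2) *
      ∑ i, (toMat n (fderiv ℝ θ x)).adjugate.mulVec (fun j => θ x j) i *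
        fderiv ℝ ψ x (EuclideanSpace.single i 1) := by
  unfold pairE
  have : (fun j => Fe n ε (θ x) j) = gprof n ε (‖θ x‖ ^ 2) • (fun j => θ x j) := rfl
  rw [this, Matrix.mulVec_smul, Finset.mul_sum]
  refine Finset.sum_congr rfl fun i _ => ?_
  simp only [Pi.smul_apply, smul_eq_mul, mul_assoc]

lemma pairE_zero_of (n : ℕ) (ε : ℝ) (θ : Euc n → Euc n) (ψ : Euc n → ℝ) (x : Euc n)
    (h : θ x = 0) : pairE n ε θ ψ x = 0 := by
  rw [pairE_eq, h]
  have : (fun j => (0 : Euc n) j) = (0 : Fin n → ℝ) := rfl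
  rw [this, Matrix.mulVec_zero]
  simp

lemma gprof_nonneg (n : ℕ) (ε s : ℝ) : 0 ≤ gprof n ε s := by
  unfold gprof
  positivity

lemma gprof_le (n : ℕ) (ε s : ℝ) (hs : 0 < s) : gprof n ε s ≤ gprof n 0 s := by
  unfold gprof
  have h0 : 0 < Real.sqrt (0 ^ 2 + s) := Real.sqrt_pos.2 (by simpa using hs)
  have h1 : Real.sqrt (0 ^ 2 + s) ≤ Real.sqrt (ε ^ 2 + s) :=
    Real.sqrt_le_sqrt (by nlinarith [sq_nonneg ε])
  gcongr

lemma pairE_le (n : ℕ) (ε : ℝ) (θ : Euc n → Euc n) (ψ : Euc n → ℝ) (x : Euc n) :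
    ‖pairE n ε θ ψ x‖ ≤ ‖pairE n 0 θ ψ x‖ := by
  by_cases h : θ x = 0
  · rw [pairE_zero_of _ _ _ _ _ h, pairE_zero_of _ _ _ _ _ h]
  · rw [pairE_eq, pairE_eq, norm_mul, norm_mul, Real.norm_of_nonneg (gprof_nonneg _ _ _),
      Real.norm_of_nonneg (gprof_nonneg _ _ _)]
    refine mul_le_mul_of_nonneg_right (gprof_le n ε _ ?_) (norm_nonneg _)
    exact pow_pos (norm_pos_iff.2 h) 2

lemma pairE_tendsto (n : ℕ) (θ : Euc n → Euc n) (ψ : Euc n → ℝ) (x : Euc n) :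
    Tendsto (fun ε => pairE n ε θ ψ x) (𝓝[>] 0) (𝓝 (pairE n 0 θ ψ x)) := by
  by_cases h : θ x = 0
  · simp only [pairE_zero_of _ _ _ _ _ h]
    exact tendsto_const_nhds
  · simp only [pairE_eq]
    refine Tendsto.mul_const _ ?_
    have hp : 0 < ‖θ x‖ ^ 2 := pow_pos (norm_pos_iff.2 h) 2
    have : ContinuousAt (fun ε => gprof n ε (‖θ x‖ ^ 2)) 0 := by
      unfold gprof
      refine continuousAt_const.mul (ContinuousAt.inv₀ (by fun_prop) ?_)
      exact (pow_pos (Real.sqrt_pos.2 (by simpa using hp)) _).ne'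
    exact this.tendsto.mono_left nhdsWithin_le_nhds

lemma pairE_continuous (n : ℕ) (ε : ℝ) (hε : 0 < ε) (θ : Euc n → Euc n) (ψ : Euc n → ℝ)
    (hθ : ContDiff ℝ 1 θ) (hψ : ContDiff ℝ 1 ψ) : Continuous (pairE n ε θ ψ) := by
  unfold pairE
  have h1 : Continuous fun x => (toMat n (fderiv ℝ θ x)).adjugate :=
    (continuous_jac n θ hθ).matrix_adjugate
  have h2 : Continuous fun x => (fun j => Fe n ε (θ x) j : Fin n → ℝ) :=
    (PiLp.continuous_ofLp 2 _).comp ((contDiff_Fe n ε hε).continuous.comp hθ.continuous)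
  have h3 := h1.matrix_mulVec h2
  have h4 : Continuous (fderiv ℝ ψ) := hψ.continuous_fderiv one_ne_zero
  exact continuous_finsetSum _ fun i _ =>
    ((continuous_apply i).comp h3).mul (h4.clm_apply continuous_const)

lemma pairE_off (n : ℕ) (ε : ℝ) (θ : Euc n → Euc n) (ψ : Euc n → ℝ) (x : Euc n)
    (h : x ∉ tsupport ψ) : pairE n ε θ ψ x = 0 := by
  unfold pairE
  rw [fderiv_of_notMem_tsupport ℝ h]
  simp

lemma pairE_integrable (n : ℕ) (hn : 1 ≤ n) (θ : Euc n → Euc n) (ψ : Euc n → ℝ)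
    (hθ : ContDiff ℝ 1 θ) (hψ : ContDiff ℝ 1 ψ) (hψc : HasCompactSupport ψ)
    (hreg : ∀ z ∈ tsupport ψ, θ z = 0 → (fderiv ℝ θ z).det ≠ 0) :
    Integrable (pairE n 0 θ ψ) := by
  have h1 : IntegrableOn (Jf n θ) (tsupport ψ) :=
    Jf_integrableOn n hn θ Set.univ _ isOpen_univ hθ.contDiffOn hψc (Set.subset_univ _) hreg
  have h4 : Continuous (fderiv ℝ ψ) := hψ.continuous_fderiv one_ne_zero
  have h2 : IntegrableOn (pairE n 0 θ ψ) (tsupport ψ) := by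
    unfold pairE
    refine integrable_finsetSum _ fun i _ => ?_
    have h5 : Integrable (fun x => Jf n θ x i) (volume.restrict (tsupport ψ)) := h1.eval i
    have h6 : Continuous fun x => fderiv ℝ ψ x (EuclideanSpace.single i 1) :=
      h4.clm_apply continuous_const
    exact IntegrableOn.mul_continuousOn h5 h6.continuousOn hψc
  rw [← integrableOn_univ]
  refine (integrableOn_iff_integrable_of_support_subset ?_).1 h2 |>.integrableOn
  intro x hx
  by_contra h
  exact hx (pairE_off n 0 θ ψ x h)

lemma limit_identity (n : ℕ) (hn : 1 ≤ n) (θ : Euc n → Euc n) (ψ : Euc n → ℝ)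
    (hθ : ContDiff ℝ 1 θ) (hθc : HasCompactSupport θ)
    (hψ : ContDiff ℝ 1 ψ) (hψc : HasCompactSupport ψ) (Z : Finset (Euc n))
    (hZ : ∀ x, x ∈ Z ↔ x ∈ tsupport ψ ∧ θ x = 0)
    (hreg : ∀ z ∈ tsupport ψ, θ z = 0 → (fderiv ℝ θ z).det ≠ 0) :
    -∫ x, pairE n 0 θ ψ x
      = ballVol n * ∑ z ∈ Z, Real.sign (fderiv ℝ θ z).det * ψ z := by
  have hInt := pairE_integrable n hn θ ψ hθ hψ hψc hreg
  have hL : Tendsto (fun ε => ∫ x, pairE n ε θ ψ x) (𝓝[>] 0) (𝓝 (∫ x, pairE n 0 θ ψ x)) := by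
    refine tendsto_integral_filter_of_dominated_convergence (fun x => ‖pairE n 0 θ ψ x‖) ?_ ?_
      hInt.norm ?_
    · filter_upwards [self_mem_nhdsWithin] with ε hε
      exact (pairE_continuous n ε hε θ ψ hθ hψ).aestronglyMeasurable
    · exact Eventually.of_forall fun ε => Eventually.of_forall fun x => pairE_le n ε θ ψ x
    · exact Eventually.of_forall fun x => pairE_tendsto n θ ψ x
  let k : Euc n → ℝ := fun x => ψ x * (toMat n (fderiv ℝ θ x)).det
  have hk : Continuous k := hψ.continuous.mul (continuous_jac n θ hθ).matrix_det
  have hkc : HasCompactSupport k := hψc.mul_right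
  have hks : tsupport k ⊆ tsupport ψ := tsupport_mul_subset_left
  have hR := global_limit n hn θ hθ.continuous k hk hkc Z
    (fun x hx h => (hZ x).2 ⟨hks hx, h⟩) (fun z => fderiv ℝ θ z)
    (fun z hz => ((hZ z).1 hz).2)
    (fun z _ => ((hθ.differentiable one_ne_zero) z).hasFDerivAt)
    (fun z hz => hreg z ((hZ z).1 hz).1 ((hZ z).1 hz).2)
  have hE : ∀ᶠ ε in 𝓝[>] (0 : ℝ), -∫ x, pairE n ε θ ψ x = ∫ x, k x * fe n ε (θ x) := by
    filter_upwards [self_mem_nhdsWithin] with ε hε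
    have := regularised_identity n hn ε hε θ ψ hθ hθc hψ hψc
    unfold pairE
    rw [this]
    congr 1
    funext x
    simp only [k]
    ring
  have := tendsto_nhds_unique (hL.neg.congr' hE) hR
  rw [this, Finset.mul_sum]
  refine Finset.sum_congr rfl fun z hz => ?_
  have hd := hreg z ((hZ z).1 hz).1 ((hZ z).1 hz).2
  have hs : (fderiv ℝ θ z).det * |(fderiv ℝ θ z).det|⁻¹ = Real.sign (fderiv ℝ θ z).det := by
    rcases lt_or_gt_of_ne hd with h | h
    · rw [Real.sign_of_neg h, abs_of_neg h]
      field_simp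
    · rw [Real.sign_of_pos h, abs_of_pos h]
      field_simp
  simp only [k, toMat_det]
  rw [← hs]
  ring

/-! ### The cutoff -/

lemma exists_cutoff (n : ℕ) (w : Euc n → Euc n) (V K : Set (Euc n)) (hV : IsOpen V)
    (hw : ContDiffOn ℝ 1 w V) (hK : IsCompact K) (hKV : K ⊆ V) :
    ∃ θ : Euc n → Euc n, ContDiff ℝ 1 θ ∧ HasCompactSupport θ ∧
      ∀ x ∈ K, θ =ᶠ[𝓝 x] w := by
  obtain ⟨t, ht, hKt, htV⟩ := exists_compact_between hK hV hKV
  obtain ⟨χ, hχ1, hχ0, -⟩ := exists_contMDiffMap_one_nhds_of_subset_interior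
    (modelWithCornersSelf ℝ (Euc n)) (n := 1) hK.isClosed hKt
  have hχ : ContDiff ℝ 1 χ := χ.contMDiff.contDiff
  have hsupp : Function.support χ ⊆ t := fun x hx => by
    by_contra h
    exact hx (hχ0 x h)
  have hts : tsupport χ ⊆ t := closure_minimal hsupp ht.isClosed
  refine ⟨fun x => χ x • w x, ?_, ?_, ?_⟩
  · refine contDiff_iff_contDiffAt.2 fun x => ?_
    by_cases hx : x ∈ V
    · exact hχ.contDiffAt.smul (hw.contDiffAt (hV.mem_nhds hx))
    · have hx' : x ∉ tsupport χ := fun h => hx (htV (hts h))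
      have h0 : (fun x => χ x • w x) =ᶠ[𝓝 x] fun _ => 0 := by
        filter_upwards [notMem_tsupport_iff_eventuallyEq.1 hx'] with y hy
        rw [hy]
        simp
      exact contDiffAt_const.congr_of_eventuallyEq h0
  · have : HasCompactSupport χ := HasCompactSupport.of_support_subset_isCompact ht hsupp
    exact this.smul_right
  · intro x hx
    filter_upwards [hχ1.filter_mono (nhds_le_nhdsSet hx)] with y hy
    rw [hy, one_smul]


/-- For a regular value `a` of a `C¹` map `u`, `Ju^a` is
`ω_n ∑_{x ∈ u⁻¹(a)} sgn(det ∇u(x)) δ_x`. -/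
theorem jacobian_proj_regular_value
    (n : ℕ) (hn : 2 ≤ n) (Ω : Set (Euc n)) (hΩo : IsOpen Ω)
    (hΩb : Bornology.IsBounded Ω) (hΩs : SmoothBoundary n Ω)
    (u : Euc n → Euc n) (V : Set (Euc n)) (hV : IsOpen V) (hΩV : closure Ω ⊆ V)
    (hu : ContDiffOn ℝ 1 u V)
    (a : Euc n) (ha₁ : a ∉ u '' frontier Ω)
    (ha₂ : ∀ x ∈ Ω, u x = a → (jacMat n u x).det ≠ 0) :
    Set.Finite {x ∈ Ω | u x = a} ∧
    IntegrableOn (fun x => jvec n (proj n u a) x) Ω ∧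
    ∀ ψ : Euc n → ℝ, Cc1 n Ω ψ →
      -∫ x in Ω, jPair n (proj n u a) ψ x =
        ballVol n * ∑ᶠ x ∈ {x ∈ Ω | u x = a}, Real.sign (jacMat n u x).det * ψ x := by
  have hn1 : 1 ≤ n := by omega
  have : Nonempty (Fin n) := ⟨⟨0, hn1⟩⟩
  have hCc : IsCompact (closure Ω) := hΩb.isCompact_closure
  let w : Euc n → Euc n := fun x => u x - a
  have hw : ContDiffOn ℝ 1 w V := hu.sub contDiffOn_const
  have hfd : ∀ x, fderiv ℝ w x = fderiv ℝ u x := fun x => fderiv_sub_const a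
  have hw0 : ∀ x, w x = 0 ↔ u x = a := fun x => sub_eq_zero
  have hin : ∀ x ∈ closure Ω, u x = a → x ∈ Ω := by
    intro x hx hxa
    by_contra hxo
    exact ha₁ ⟨x, ⟨hx, by rwa [hΩo.interior_eq]⟩, hxa⟩
  have hdiffu : ∀ x ∈ V, DifferentiableAt ℝ u x := fun x hx =>
    (hu.differentiableOn one_ne_zero).differentiableAt (hV.mem_nhds hx)
  have hΩV' : Ω ⊆ V := subset_closure.trans hΩV
  have hdet : ∀ x ∈ Ω, u x = a → (fderiv ℝ w x).det ≠ 0 := by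
    intro x hx hxa
    rw [hfd, ← toMat_det, ← jacMat_eq]
    exact ha₂ x hx hxa
  have hfin : Set.Finite {x ∈ Ω | u x = a} := by
    refine zeros_finite n w (closure Ω) _ hCc (hw.continuousOn.mono hΩV) ?_ ?_
    · ext x
      exact ⟨fun h => ⟨subset_closure h.1, (hw0 x).2 h.2⟩,
        fun h => ⟨hin x h.1 ((hw0 x).1 h.2), (hw0 x).1 h.2⟩⟩
    · intro z hz
      refine ⟨fderiv ℝ w z, ?_, hdet z hz.1 hz.2⟩
      exact ((hw.differentiableOn one_ne_zero).differentiableAt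
        (hV.mem_nhds (hΩV' hz.1))).hasFDerivAt
  have hne : ∀ᵐ x : Euc n, x ∉ {x ∈ Ω | u x = a} :=
    measure_eq_zero_iff_ae_notMem.1 (hfin.measure_zero _)
  have hJ : ∀ x ∈ Ω, x ∉ {x ∈ Ω | u x = a} → jvec n (proj n u a) x = Jf n w x := by
    intro x hx hxn
    have hxa : u x ≠ a := fun h => hxn ⟨hx, h⟩
    rw [jvec_proj n hn1 u a x (hdiffu x (hΩV' hx)) hxa, Jf, hfd, jacMat_eq]
  refine ⟨hfin, ?_, ?_⟩
  · have h1 : IntegrableOn (Jf n w) Ω :=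
      (Jf_integrableOn n hn1 w V (closure Ω) hV hw hCc hΩV fun z hz h =>
        hdet z (hin z hz ((hw0 z).1 h)) ((hw0 z).1 h)).mono_set subset_closure
    refine Integrable.congr h1 ?_
    refine (ae_restrict_iff' hΩo.measurableSet).2 ?_
    filter_upwards [hne] with x hx hxΩ using (hJ x hxΩ hx).symm
  · rintro ψ ⟨hψ, hψc, hψΩ⟩
    obtain ⟨θ, hθ, hθc, hθw⟩ := exists_cutoff n w V (tsupport ψ) hV hw hψc (hψΩ.trans hΩV')
    have hθe : ∀ x ∈ tsupport ψ, θ x = w x := fun x hx => (hθw x hx).self_of_nhds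
    have hθf : ∀ x ∈ tsupport ψ, fderiv ℝ θ x = fderiv ℝ w x := fun x hx => (hθw x hx).fderiv_eq
    classical
    let Z : Finset (Euc n) := hfin.toFinset.filter (fun x => x ∈ tsupport ψ)
    have hZ : ∀ x, x ∈ Z ↔ x ∈ tsupport ψ ∧ θ x = 0 := by
      intro x
      rw [Finset.mem_filter, Set.Finite.mem_toFinset]
      constructor
      · rintro ⟨h1, h2⟩
        exact ⟨h2, by rw [hθe x h2]; exact (hw0 x).2 h1.2⟩
      · rintro ⟨h1, h2⟩
        rw [hθe x h1] at h2
        exact ⟨⟨hψΩ h1, (hw0 x).1 h2⟩, h1⟩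
    have hreg : ∀ z ∈ tsupport ψ, θ z = 0 → (fderiv ℝ θ z).det ≠ 0 := by
      intro z hz h
      rw [hθe z hz] at h
      rw [hθf z hz]
      exact hdet z (hψΩ hz) ((hw0 z).1 h)
    have hmain := limit_identity n hn1 θ ψ hθ hθc hψ hψc Z hZ hreg
    have hI : ∫ x in Ω, jPair n (proj n u a) ψ x = ∫ x, pairE n 0 θ ψ x := by
      rw [← setIntegral_eq_integral_of_forall_compl_eq_zero (s := Ω)
        (fun x hx => pairE_off n 0 θ ψ x fun h => hx (hψΩ h))]
      refine setIntegral_congr_ae hΩo.measurableSet ?_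
      filter_upwards [hne] with x hx hxΩ
      by_cases hxs : x ∈ tsupport ψ
      · unfold jPair pairE
        rw [hJ x hxΩ hx, Jf, hθe x hxs, hθf x hxs]
      · rw [pairE_off n 0 θ ψ x hxs]
        unfold jPair
        rw [fderiv_of_notMem_tsupport ℝ hxs]
        simp
    rw [hI, hmain, finsum_mem_eq_finite_toFinset_sum _ hfin]
    congr 1
    have hsum : ∑ z ∈ Z, Real.sign (jacMat n u z).det * ψ z
        = ∑ z ∈ hfin.toFinset, Real.sign (jacMat n u z).det * ψ z := by
      refine Finset.sum_filter_of_ne fun z _ hz => ?_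
      by_contra h
      exact hz (by rw [image_eq_zero_of_notMem_tsupport h, mul_zero])
    rw [← hsum]
    refine Finset.sum_congr rfl fun z hz => ?_
    rw [hθf z ((hZ z).1 hz).1, hfd, ← toMat_det, ← jacMat_eq]

end
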